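/- Let K be a clique complex and L a clique subcomplex of K such that for every pair of vertices v, w of L with (st_K(v) ∩ st_K(w)) \ L nonempty, the edge {v, w} lies in L. Then: (i) L is a full subcomplex of K; and (ii) for any vertices v_1, …, v_ℓ of L, the complex L ∪ st_K(v_1) ∪ ⋯ ∪ st_K(v_ℓ) is homotopy equivalent to L. In particular, the star cluster SC_K(L) is homotopy equivalent to L. -/

import Mathlib

open Finset

/-- An abstract simplicial complex on a vertex type `V`: a collection of nonempty
finite subsets of `V` (the faces), closed under taking nonempty subsets. -/
structure AbsSC (V : Type) where
  faces : Set (Finset V)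
  not_empty_mem : ∅ ∉ faces
  down_closed : ∀ s ∈ faces, ∀ t : Finset V, t ⊆ s → t ≠ ∅ → t ∈ faces

namespace AbsSC

variable {V W : Type}

/-- The vertex set of a simplicial complex. -/
def vertices (K : AbsSC V) : Set V := {v | ({v} : Finset V) ∈ K.faces}

/-- The geometric realization of a simplicial complex: the space of convex weightings
supported on a face, topologized as a subspace of `V → ℝ`. -/
def space (K : AbsSC V) : Type :=
  {f : V → ℝ // (∀ v, 0 ≤ f v) ∧ ∃ s ∈ K.faces, (∀ v, f v ≠ 0 → v ∈ s) ∧ ∑ v ∈ s, f v = 1}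

instance (K : AbsSC V) : TopologicalSpace K.space := by unfold space; infer_instance

/-- `L` is a subcomplex of `K`. -/
def IsSubcomplex (L K : AbsSC V) : Prop := L.faces ⊆ K.faces

/-- Homotopy equivalence of simplicial complexes (of their geometric realizations). -/
def HEquiv (K : AbsSC V) (L : AbsSC W) : Prop :=
  Nonempty (ContinuousMap.HomotopyEquiv K.space L.space)

/-- The realization of `K` is homotopy equivalent to the topological space `X`. -/
def HEquivTop (K : AbsSC V) (X : Type) [TopologicalSpace X] : Prop :=
  Nonempty (ContinuousMap.HomotopyEquiv K.space X)

/-- The inclusion of realizations induced by a subcomplex inclusion. -/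
def incl {L K : AbsSC V} (h : L.faces ⊆ K.faces) : C(L.space, K.space) where
  toFun f := ⟨f.1, f.2.1, by obtain ⟨s, hs, h1, h2⟩ := f.2.2; exact ⟨s, h hs, h1, h2⟩⟩
  continuous_toFun := Continuous.subtype_mk continuous_subtype_val _

variable [DecidableEq V]

/-- The link of a vertex. -/
def link (K : AbsSC V) (v : V) : AbsSC V where
  faces := {σ | σ ≠ ∅ ∧ v ∉ σ ∧ σ ∪ {v} ∈ K.faces}
  not_empty_mem h := h.1 rfl
  down_closed := by
    rintro s ⟨hne, hv, hs⟩ t hts htne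
    exact ⟨htne, fun hvt => hv (hts hvt),
      K.down_closed _ hs _ (Finset.union_subset_union hts (Finset.Subset.refl _)) (by simp [Finset.union_eq_empty])⟩

lemma link_subset (K : AbsSC V) (v : V) : (K.link v).faces ⊆ K.faces := by
  rintro σ ⟨hne, hv, hσ⟩
  exact K.down_closed _ hσ _ Finset.subset_union_left hne

/-- The complex induced on the vertices other than `v`. -/
def delete (K : AbsSC V) (v : V) : AbsSC V where
  faces := {σ | σ ∈ K.faces ∧ v ∉ σ}
  not_empty_mem h := K.not_empty_mem h.1
  down_closed := by
    rintro s ⟨hs, hv⟩ t hts htne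
    exact ⟨K.down_closed _ hs _ hts htne, fun h => hv (hts h)⟩

/-- The star of a vertex: `st_K(v) = {σ : σ ∪ {v} ∈ K}`. -/
def star (K : AbsSC V) (v : V) : AbsSC V where
  faces := {σ | σ ≠ ∅ ∧ σ ∪ {v} ∈ K.faces}
  not_empty_mem h := h.1 rfl
  down_closed := by
    rintro s ⟨hne, hs⟩ t hts htne
    exact ⟨htne,
      K.down_closed _ hs _ (Finset.union_subset_union hts (Finset.Subset.refl _)) (by simp [Finset.union_eq_empty])⟩

/-- The star cluster of a subcomplex `L` in `K`: the union of stars of vertices of `L`. -/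
def starCluster (K L : AbsSC V) : AbsSC V where
  faces := {σ | σ ≠ ∅ ∧ ∃ v, ({v} : Finset V) ∈ L.faces ∧ σ ∪ {v} ∈ K.faces}
  not_empty_mem h := h.1 rfl
  down_closed := by
    rintro s ⟨hne, v, hvL, hs⟩ t hts htne
    exact ⟨htne, v, hvL,
      K.down_closed _ hs _ (Finset.union_subset_union hts (Finset.Subset.refl _)) (by simp [Finset.union_eq_empty])⟩

/-- The union of two simplicial complexes. -/
def union (K₁ K₂ : AbsSC V) : AbsSC V where
  faces := K₁.faces ∪ K₂.faces
  not_empty_mem h := by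
    rcases h with h | h
    exacts [K₁.not_empty_mem h, K₂.not_empty_mem h]
  down_closed := by
    rintro s (hs | hs) t hts htne
    exacts [Or.inl (K₁.down_closed _ hs _ hts htne), Or.inr (K₂.down_closed _ hs _ hts htne)]

/-- The union of a family of simplicial complexes. -/
def iUnionC {ι : Type} (F : ι → AbsSC V) : AbsSC V where
  faces := ⋃ i, (F i).faces
  not_empty_mem h := by
    obtain ⟨i, hi⟩ := Set.mem_iUnion.mp h
    exact (F i).not_empty_mem hi
  down_closed := by
    intro s hs t hts htne
    obtain ⟨i, hi⟩ := Set.mem_iUnion.mp hs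
    exact Set.mem_iUnion.mpr ⟨i, (F i).down_closed _ hi _ hts htne⟩

/-- The `n`-skeleton of a complex: all faces with at most `n+1` vertices. -/
def skeleton (K : AbsSC V) (n : ℕ) : AbsSC V where
  faces := {σ | σ ∈ K.faces ∧ σ.card ≤ n + 1}
  not_empty_mem h := K.not_empty_mem h.1
  down_closed := by
    rintro s ⟨hs, hcard⟩ t hts htne
    exact ⟨K.down_closed _ hs _ hts htne, le_trans (Finset.card_le_card hts) hcard⟩

/-- The simplicial complex generated by a single simplex `s` (all its nonempty subsets). -/
def simplexCx (s : Finset V) : AbsSC V where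
  faces := {t | t ≠ ∅ ∧ t ⊆ s}
  not_empty_mem h := h.1 rfl
  down_closed := by
    rintro a ⟨hne, has⟩ t hta htne
    exact ⟨htne, hta.trans has⟩

/-- A maximal simplex (facet) of `K`. -/
def IsFacet (K : AbsSC V) (σ : Finset V) : Prop :=
  σ ∈ K.faces ∧ ∀ τ ∈ K.faces, σ ⊆ τ → τ = σ

/-- `K` is a clique complex: any nonempty set of vertices which pairwise span edges is a face. -/
def IsCliqueCx (K : AbsSC V) : Prop :=
  ∀ σ : Finset V, σ ≠ ∅ → (∀ v ∈ σ, ({v} : Finset V) ∈ K.faces) →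
    (∀ v ∈ σ, ∀ w ∈ σ, v ≠ w → ({v, w} : Finset V) ∈ K.faces) → σ ∈ K.faces

/-- `L` is a full subcomplex of `K`. -/
def IsFull (L K : AbsSC V) : Prop :=
  ∀ σ ∈ K.faces, (∀ v ∈ σ, ({v} : Finset V) ∈ L.faces) → σ ∈ L.faces

end AbsSC

noncomputable section

/-- The `n`-dimensional sphere. -/
abbrev Sph (n : ℕ) : Type := Metric.sphere (0 : EuclideanSpace ℝ (Fin (n + 1))) 1

/-- A base point on the sphere. -/
def sphBase (n : ℕ) : Sph n :=
  ⟨EuclideanSpace.single 0 1, by simp⟩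

/-- Relation gluing the base points of `c` copies of a pointed space to an auxiliary point. -/
inductive wedgeRel (c : ℕ) (X : Type) (x₀ : X) : Unit ⊕ Fin c × X → Unit ⊕ Fin c × X → Prop
  | glue (i : Fin c) : wedgeRel c X x₀ (Sum.inl ()) (Sum.inr (i, x₀))

/-- The wedge sum of `c` copies of the pointed space `(X, x₀)`. -/
def Wedge (c : ℕ) (X : Type) [TopologicalSpace X] (x₀ : X) : Type := Quot (wedgeRel c X x₀)

instance (c : ℕ) (X : Type) [TopologicalSpace X] (x₀ : X) : TopologicalSpace (Wedge c X x₀) := by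
  unfold Wedge; infer_instance

/-- The base point of the wedge. -/
def wedgePt (c : ℕ) (X : Type) [TopologicalSpace X] (x₀ : X) : Wedge c X x₀ :=
  Quot.mk _ (Sum.inl ())

/-- The wedge sum of `c` copies of the `n`-sphere. -/
abbrev WedgeSph (n c : ℕ) : Type := Wedge c (Sph n) (sphBase n)

/-- The base point of a wedge of spheres. -/
def wedgeSphPt (n c : ℕ) : WedgeSph n c := wedgePt c _ _

/-- Relation gluing the two base points in a binary wedge. -/
inductive wedge2Rel (X Y : Type) (x₀ : X) (y₀ : Y) : X ⊕ Y → X ⊕ Y → Prop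
  | glue : wedge2Rel X Y x₀ y₀ (Sum.inl x₀) (Sum.inr y₀)

/-- The wedge sum `X ∨ Y` of two pointed spaces. -/
def Wedge2 (X Y : Type) [TopologicalSpace X] [TopologicalSpace Y] (x₀ : X) (y₀ : Y) : Type :=
  Quot (wedge2Rel X Y x₀ y₀)

instance (X Y : Type) [TopologicalSpace X] [TopologicalSpace Y] (x₀ : X) (y₀ : Y) :
    TopologicalSpace (Wedge2 X Y x₀ y₀) := by unfold Wedge2; infer_instance

/-- Relation collapsing the top and bottom of the cylinder `X × [0,1]` to two cone points. -/
inductive suspRel (X : Type) : X × unitInterval ⊕ Bool → X × unitInterval ⊕ Bool → Prop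
  | zero (x : X) : suspRel X (Sum.inl (x, 0)) (Sum.inr false)
  | one (x : X) : suspRel X (Sum.inl (x, 1)) (Sum.inr true)

/-- The (unreduced) suspension `Σ X`. -/
def Susp (X : Type) [TopologicalSpace X] : Type := Quot (suspRel X)

instance (X : Type) [TopologicalSpace X] : TopologicalSpace (Susp X) := by
  unfold Susp; infer_instance

/-- The north cone point of the suspension. -/
def suspNorth (X : Type) [TopologicalSpace X] : Susp X := Quot.mk _ (Sum.inr true)

end

/-- The Vietoris–Rips complex at scale `r` of a collection `F` of finite subsets of `ℕ`,
with respect to the symmetric difference metric `d(A,B) = |A Δ B|`. -/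
def VRc (F : Set (Finset ℕ)) (r : ℕ) : AbsSC (Finset ℕ) where
  faces := {σ | σ.Nonempty ∧ (∀ A ∈ σ, A ∈ F) ∧
    ∀ A ∈ σ, ∀ B ∈ σ, (symmDiff A B).card ≤ r}
  not_empty_mem h := by simpa using h.1
  down_closed := by
    rintro s ⟨hne, hF, hd⟩ t hts htne
    exact ⟨Finset.nonempty_iff_ne_empty.mpr htne, fun A hA => hF A (hts hA),
      fun A hA B hB => hd A (hts hA) B (hts hB)⟩

/-- `F_n^m`: all `n`-element subsets of `[m] = {1, …, m}`. -/
def Fnm (m n : ℕ) : Set (Finset ℕ) := {A | A ⊆ Finset.Icc 1 m ∧ A.card = n}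

/-- `F_{≤ n}^m`: all subsets of `[m]` of cardinality at most `n`. -/
def Fle (m n : ℕ) : Set (Finset ℕ) := {A | A ⊆ Finset.Icc 1 m ∧ A.card ≤ n}

/-- The simplex `N[C] = {A : C ⊆ A, |A \ C| = 1}` inside `[m]`. -/
def NSimp (m : ℕ) (C : Finset ℕ) : Finset (Finset ℕ) :=
  (Finset.Icc 1 m \ C).image (fun x => insert x C)

/-- The simplex `L[S]`: all subsets of `S` obtained by removing one element. -/
def LSimp (S : Finset ℕ) : Finset (Finset ℕ) := S.image (fun x => S.erase x)

/-- The total order `≺`: first compare cardinalities, then compare the increasing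
enumerations lexicographically. -/
def precLT (A B : Finset ℕ) : Prop :=
  A.card < B.card ∨
    (A.card = B.card ∧ List.Lex (· < ·) (A.sort (· ≤ ·)) (B.sort (· ≤ ·)))

/-- `A ⪯ B`. -/
def precLE (A B : Finset ℕ) : Prop := precLT A B ∨ A = B

/-- `F^m_{≺ A}`: all subsets of `[m]` strictly preceding `A`. -/
def FprecLT (m : ℕ) (A : Finset ℕ) : Set (Finset ℕ) :=
  {B | B ⊆ Finset.Icc 1 m ∧ precLT B A}

/-- `F^m_{⪯ A}`: all subsets of `[m]` preceding (or equal to) `A`. -/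
def FprecLE (m : ℕ) (A : Finset ℕ) : Set (Finset ℕ) :=
  {B | B ⊆ Finset.Icc 1 m ∧ precLE B A}

/-- The `j`-th value (0-indexed) of an enumeration `i : Fin n → ℕ`. -/
def ith {n : ℕ} (i : Fin n → ℕ) (j : ℕ) : ℕ := if h : j < n then i ⟨j, h⟩ else 0

/-- The `ℓ`-th entry (1-indexed) of the enumeration, as an integer, with `i_0 = -1`. -/
def ivZ {n : ℕ} (i : Fin n → ℕ) (ℓ : ℕ) : ℤ := if ℓ = 0 then -1 else (ith i (ℓ - 1) : ℤ)

/-- For `B = i_1 i_2 ⋯ i_n` (increasing), with `d_1 = i_1` and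
`d_ℓ = i_ℓ - (i_{ℓ-1} + 1)`, `r_B = Σ_{k=2}^{n-2} C(k,2) + Σ_{ℓ=1}^{n-2} d_ℓ·C(n-ℓ,2)`. -/
def rA (B : Finset ℕ) : ℕ :=
  (∑ k ∈ Finset.Icc 2 (B.card - 2), Nat.choose k 2) +
    ∑ ℓ ∈ Finset.Icc 1 (B.card - 2),
      ((B.sort (· ≤ ·)).getD (ℓ - 1) 0 -
        (if ℓ = 1 then 0 else (B.sort (· ≤ ·)).getD (ℓ - 2) 0 + 1)) * Nat.choose (B.card - ℓ) 2

/-- For `B = i_1 i_2 ⋯ i_n` (increasing), with `c_1 = i_1 - 1` and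
`c_ℓ = i_ℓ - (i_{ℓ-1} + 1)`, `s_B = Σ_{k=2}^{n-2} C(k,2) + Σ_{ℓ=1}^{n-2} c_ℓ·C(n-ℓ,2)`. -/
def sA (B : Finset ℕ) : ℕ :=
  (∑ k ∈ Finset.Icc 2 (B.card - 2), Nat.choose k 2) +
    ∑ ℓ ∈ Finset.Icc 1 (B.card - 2),
      ((B.sort (· ≤ ·)).getD (ℓ - 1) 0 -
        (if ℓ = 1 then 1 else (B.sort (· ≤ ·)).getD (ℓ - 2) 0 + 1)) * Nat.choose (B.card - ℓ) 2

/-- `t_n = Σ_{A ⊆ [m], |A| = n} r_A`. -/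
def tN (m n : ℕ) : ℕ :=
  ∑ A ∈ (Finset.Icc 1 m).powerset.filter (fun A => A.card = n), rA A

/-- `o_{m,n} = Σ { s_A : A ∈ F^m_{n+2}, min A ≥ 2 }`. -/
def omn (m n : ℕ) : ℕ :=
  ∑ A ∈ (Finset.Icc 1 m).powerset.filter (fun A => A.card = n + 2 ∧ ∀ x ∈ A, 2 ≤ x), sA A

namespace AbsSC

open MeasureTheory Filter Topology

section Realization

variable {V : Type} {X : AbsSC V}

lemma space_sum_le_one (x : X.space) (T : Finset V) : ∑ v ∈ T, x.1 v ≤ 1 := by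
  classical
  obtain ⟨h0, s, -, hs, h1⟩ := x.2
  calc ∑ v ∈ T, x.1 v = ∑ v ∈ T with x.1 v ≠ 0, x.1 v := (Finset.sum_filter_ne_zero T).symm
    _ ≤ ∑ v ∈ s, x.1 v := by
      refine Finset.sum_le_sum_of_subset_of_nonneg (fun v hv => ?_) (fun v _ _ => h0 v)
      exact hs v (Finset.mem_filter.mp hv).2
    _ = 1 := h1

lemma space_le_one (x : X.space) (v : V) : x.1 v ≤ 1 := by
  simpa using space_sum_le_one x {v}

lemma continuous_coord (v : V) : Continuous fun x : X.space => x.1 v :=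
  (continuous_apply v).comp continuous_subtype_val

/-- The support of a point of the realization is a face. -/
lemma exists_support_mem_faces (x : X.space) :
    ∃ s ∈ X.faces, (∀ v, v ∈ s ↔ x.1 v ≠ 0) ∧ ∑ v ∈ s, x.1 v = 1 := by
  classical
  obtain ⟨-, s, hs, hsupp, h1⟩ := x.2
  have hsum : ∑ v ∈ s with x.1 v ≠ 0, x.1 v = 1 := by rw [Finset.sum_filter_ne_zero, h1]
  refine ⟨{v ∈ s | x.1 v ≠ 0}, X.down_closed _ hs _ (Finset.filter_subset _ _) ?_, ?_, hsum⟩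
  · intro h
    rw [h] at hsum
    simp at hsum
  · intro v
    simpa using hsupp v

lemma coord_add_sum_le_one (x : X.space) {F : Finset V} {u : V} (hu : u ∉ F) :
    x.1 u ≤ 1 - ∑ v ∈ F, x.1 v := by
  classical
  have h := space_sum_le_one x (insert u F)
  rw [Finset.sum_insert hu] at h
  linarith

/-- Coordinates outside the support of `x` are uniformly small near `x`. -/
lemma eventually_coord_lt (x : X.space) {F : Finset V} (hF : ∑ v ∈ F, x.1 v = 1)
    {ε : ℝ} (hε : 0 < ε) : ∀ᶠ y in 𝓝 x, ∀ u ∉ F, y.1 u < ε := by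
  have hc : Continuous fun y : X.space => 1 - ∑ v ∈ F, y.1 v :=
    continuous_const.sub (continuous_finsetSum _ fun v _ => continuous_coord v)
  have h := hc.tendsto x
  simp only [hF, sub_self] at h
  filter_upwards [h.eventually_lt_const hε] with y hy u hu
  exact (coord_add_sum_le_one y hu).trans_lt hy

/-- The topology of the realization is first countable, even for uncountable vertex sets. -/
lemma isCountablyGenerated_nhds_space (x : X.space) : (𝓝 x).IsCountablyGenerated := by
  obtain ⟨F, -, hF, hF1⟩ := exists_support_mem_faces x
  have key : 𝓝 x = comap (fun (y : X.space) (u : {u // u ∈ F}) => y.1 u) (𝓝 fun u : {u // u ∈ F} => x.1 u) := by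
    have hcoord : ∀ u ∈ F, Tendsto (fun y : X.space => y.1 u)
        (comap (fun (y : X.space) (u : {u // u ∈ F}) => y.1 u) (𝓝 fun u : {u // u ∈ F} => x.1 u)) (𝓝 (x.1 u)) :=
      fun u hu => tendsto_pi_nhds.mp
        (tendsto_comap (f := fun (y : X.space) (u : {u // u ∈ F}) => y.1 u)) (⟨u, hu⟩ : {u // u ∈ F})
    apply le_antisymm
    · rw [← tendsto_iff_comap]
      exact (continuous_pi fun u : {u // u ∈ F} => continuous_coord u.1).tendsto x
    · refine tendsto_id'.mp ?_
      refine tendsto_subtype_rng.mpr (tendsto_pi_nhds.mpr fun u => ?_)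
      by_cases hu : u ∈ F
      · exact hcoord u hu
      · have hx : x.1 u = 0 := not_not.mp fun h => hu ((hF u).mpr h)
        have hlim := (tendsto_finsetSum F hcoord).const_sub 1
        rw [hF1, sub_self] at hlim
        change Tendsto (fun y : X.space => y.1 u) _ (𝓝 (x.1 u))
        rw [hx]
        exact squeeze_zero (fun y => y.2.1 u) (fun y => coord_add_sum_le_one y hu) hlim
  rw [key]
  infer_instance

/-- A sum of continuous functions, each dominated by a barycentric coordinate, is continuous. -/
lemma tendsto_tsum_of_le_coord {ι : Type} {l : Filter ι} {y : ι → X.space} {x : X.space}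
    (hy : Tendsto y l (𝓝 x)) {g : X.space → V → ℝ} {f : ι → V → ℝ}
    (hf0 : ∀ i u, 0 ≤ f i u) (hf : ∀ i u, f i u ≤ (y i).1 u)
    (hg0 : ∀ u, 0 ≤ g x u) (hg : ∀ u, g x u ≤ x.1 u)
    (h : ∀ u, Tendsto (fun i => f i u) l (𝓝 (g x u))) :
    Tendsto (fun i => ∑' u, f i u) l (𝓝 (∑' u, g x u)) := by
  classical
  obtain ⟨F, -, hF, hF1⟩ := exists_support_mem_faces x
  have hgsum : ∑' u, g x u = ∑ u ∈ F, g x u := by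
    refine tsum_eq_sum fun u hu => ?_
    have hx : x.1 u = 0 := not_not.mp fun h => hu ((hF u).mpr h)
    exact le_antisymm (hx ▸ hg u) (hg0 u)
  rw [hgsum]
  have hlow : Tendsto (fun i => ∑ u ∈ F, f i u) l (𝓝 (∑ u ∈ F, g x u)) :=
    tendsto_finsetSum _ fun u _ => h u
  have hc : Continuous fun y : X.space => 1 - ∑ v ∈ F, y.1 v :=
    continuous_const.sub (continuous_finsetSum _ fun v _ => continuous_coord v)
  have htail := (hc.tendsto x).comp hy
  simp only [hF1, sub_self] at htail
  have hup := hlow.add htail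
  rw [add_zero] at hup
  have hsum : ∀ i, ∃ T : Finset V, ∑' u, f i u = ∑ u ∈ F, f i u + ∑ u ∈ T, f i u ∧
      Disjoint F T := by
    intro i
    obtain ⟨G, -, hG, -⟩ := exists_support_mem_faces (y i)
    refine ⟨G \ F, ?_, Finset.disjoint_sdiff⟩
    rw [← Finset.sum_union Finset.disjoint_sdiff]
    refine tsum_eq_sum fun u hu => ?_
    have hu' : u ∉ G := fun hG' => hu (by simp [hG'])
    have hx : (y i).1 u = 0 := not_not.mp fun h => hu' ((hG u).mpr h)
    exact le_antisymm (hx ▸ hf i u) (hf0 i u)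
  refine tendsto_of_tendsto_of_tendsto_of_le_of_le hlow hup (fun i => ?_) (fun i => ?_)
  · obtain ⟨T, hT, -⟩ := hsum i
    dsimp only
    rw [hT]
    linarith [Finset.sum_nonneg fun u (_ : u ∈ T) => hf0 i u]
  · obtain ⟨T, hT, hd⟩ := hsum i
    dsimp only [Function.comp]
    rw [hT]
    have h1 := space_sum_le_one (y i) (F ∪ T)
    rw [Finset.sum_union hd] at h1
    have h2 := Finset.sum_le_sum fun u (_ : u ∈ T) => hf i u
    linarith

/-- A nonnegative weighting of total mass one whose support is a face lies in the realization. -/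
lemma mem_space_of_support {f : V → ℝ} (h0 : ∀ v, 0 ≤ f v) (E : Finset V)
    (hE : ∀ v, f v ≠ 0 → v ∈ E) (h1 : ∑ v ∈ E, f v = 1)
    (hface : ∀ T : Finset V, T ≠ ∅ → (∀ v, v ∈ T ↔ f v ≠ 0) → T ∈ X.faces) :
    (∀ v, 0 ≤ f v) ∧ ∃ s ∈ X.faces, (∀ v, f v ≠ 0 → v ∈ s) ∧ ∑ v ∈ s, f v = 1 := by
  classical
  have hsum : ∑ v ∈ E with f v ≠ 0, f v = 1 := by rw [Finset.sum_filter_ne_zero, h1]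
  have hmem : ∀ v, v ∈ ({v ∈ E | f v ≠ 0} : Finset V) ↔ f v ≠ 0 := fun v => by
    simpa using hE v
  refine ⟨h0, _, hface _ ?_ hmem, fun v hv => (hmem v).mpr hv, hsum⟩
  intro h
  rw [h] at hsum
  simp at hsum

end Realization

section Push

variable {V : Type}

/-- The vertices outside `L` at which the weighting `x` exceeds the level `σ`. -/
def outerLevel (L : AbsSC V) (x : V → ℝ) (σ : ℝ) : Set V :=
  {u | ({u} : Finset V) ∉ L.faces ∧ σ < x u}

/-- The levels below `s` at which mass of the outer vertex `u` is sent to the vertex `w`,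
where `c` chooses the target from the outer superlevel set. -/
def transferLevels (L : AbsSC V) (c : Set V → V) (x : V → ℝ) (s : ℝ) (u w : V) : Set ℝ :=
  {σ | ({u} : Finset V) ∉ L.faces ∧ 0 < σ ∧ σ < x u ∧ σ < s ∧ c (outerLevel L x σ) = w}

/-- The mass sent from the outer vertex `u` to the vertex `w` up to level `s`. -/
noncomputable def transfer (L : AbsSC V) (c : Set V → V) (x : V → ℝ) (s : ℝ) (u w : V) : ℝ :=
  volume.real (transferLevels L c x s u w)

open Classical in
/-- Push the mass lying below level `s` on outer vertices onto the vertices of `L`. -/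
noncomputable def push (L : AbsSC V) (c : Set V → V) (s : ℝ) (x : V → ℝ) (w : V) : ℝ :=
  if ({w} : Finset V) ∈ L.faces then x w + ∑' u, transfer L c x s u w else max (x w - s) 0

variable {X L : AbsSC V} {c : Set V → V}

lemma outerLevel_antitone (x : V → ℝ) : Antitone (outerLevel L x) :=
  fun _ _ h _ hu => ⟨hu.1, h.trans_lt hu.2⟩

lemma transferLevels_subset (x : V → ℝ) (s : ℝ) (u w : V) :
    transferLevels L c x s u w ⊆ Set.Ioo 0 (min (x u) s) :=
  fun _ h => ⟨h.2.1, lt_min h.2.2.1 h.2.2.2.1⟩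

lemma volume_transferLevels_ne_top (x : V → ℝ) (s : ℝ) (u w : V) :
    volume (transferLevels L c x s u w) ≠ ⊤ :=
  ((measure_mono (transferLevels_subset _ _ _ _)).trans_lt (by simp)).ne

lemma transfer_nonneg (x : V → ℝ) (s : ℝ) (u w : V) : 0 ≤ transfer L c x s u w :=
  measureReal_nonneg

lemma transfer_le (x : X.space) (s : ℝ) (u w : V) : transfer L c x.1 s u w ≤ x.1 u := by
  have hsub : transferLevels L c x.1 s u w ⊆ Set.Ioo 0 (x.1 u) := fun σ h => ⟨h.2.1, h.2.2.1⟩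
  refine (measureReal_mono hsub (by simp)).trans ?_
  rw [Real.volume_real_Ioo_of_le (x.2.1 u), sub_zero]

lemma transfer_eq_zero_of_coord (x : X.space) {u : V} (hu : x.1 u = 0) (s : ℝ) (w : V) :
    transfer L c x.1 s u w = 0 :=
  le_antisymm ((transfer_le x s u w).trans_eq hu) (transfer_nonneg _ _ _ _)

lemma measurableSet_transferLevels (x : X.space) (s : ℝ) (u w : V) :
    MeasurableSet (transferLevels L c x.1 s u w) := by
  classical
  obtain ⟨F, -, hF, -⟩ := exists_support_mem_faces x
  by_cases hu : ({u} : Finset V) ∈ L.faces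
  · convert MeasurableSet.empty
    ext σ
    simp [transferLevels, hu]
  have heq : transferLevels L c x.1 s u w = Set.Ioo 0 (min (x.1 u) s) ∩
      ⋃ T ∈ (F.powerset.filter fun T : Finset V => c (T : Set V) = w),
        {σ | outerLevel L x.1 σ = (T : Set V)} := by
    ext σ
    simp only [transferLevels, Set.mem_inter_iff, Set.mem_Ioo, lt_min_iff, Set.mem_iUnion,
      Set.mem_ofPred_eq, Finset.mem_filter, Finset.mem_powerset, exists_prop]
    constructor
    · rintro ⟨-, h0, h1, h2, h3⟩
      have hT : outerLevel L x.1 σ =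
          ((F.filter fun v => v ∈ outerLevel L x.1 σ : Finset V) : Set V) := by
        ext v
        simp only [Finset.coe_filter, Set.mem_ofPred_eq]
        exact ⟨fun h => ⟨(hF v).mpr (h0.trans h.2).ne', h⟩, fun h => h.2⟩
      exact ⟨⟨h0, h1, h2⟩, _, ⟨Finset.filter_subset _ _, by rw [← hT, h3]⟩, hT⟩
    · rintro ⟨⟨h0, h1, h2⟩, T, ⟨-, hT⟩, h⟩
      exact ⟨hu, h0, h1, h2, by rw [h, hT]⟩
  rw [heq]
  refine measurableSet_Ioo.inter (Finset.measurableSet_biUnion _ fun T _ => ?_)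
  refine Set.OrdConnected.measurableSet ⟨fun a ha b hb d hd => ?_⟩
  apply Set.Subset.antisymm
  · exact (outerLevel_antitone x.1 hd.1).trans (le_of_eq ha)
  · exact (le_of_eq hb.symm).trans (outerLevel_antitone x.1 hd.2)

lemma continuous_transfer (u w : V) :
    Continuous fun p : unitInterval × X.space => transfer L c p.2.1 p.1 u w := by
  rw [continuous_iff_continuousAt]
  rintro ⟨s, x⟩
  obtain ⟨F, -, hF, hF1⟩ := exists_support_mem_faces x
  have := isCountablyGenerated_nhds_space x
  have : (𝓝 (s, x)).IsCountablyGenerated := by rw [nhds_prod_eq]; infer_instance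
  refine (ENNReal.tendsto_toReal (volume_transferLevels_ne_top _ _ _ _)).comp (tendsto_measure_of_ae_tendsto_indicator (𝓝 (s, x))
    (A := transferLevels L c x.1 s u w) (B := Set.Ioo 0 1)
    (As := fun p : unitInterval × X.space => transferLevels L c p.2.1 p.1 u w)
    (measurableSet_transferLevels x _ u w)
    (fun p => measurableSet_transferLevels p.2 _ u w) measurableSet_Ioo (by simp)
    (Eventually.of_forall fun p σ h => ⟨h.2.1, h.2.2.2.1.trans_le p.1.2.2⟩) ?_)
  have hfin : (insert (s : ℝ) (x.1 '' F)).Finite := (F.finite_toSet.image _).insert _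
  filter_upwards [compl_mem_ae_iff.mpr (hfin.measure_zero volume)] with σ hσ
  simp only [Set.mem_compl_iff, Set.mem_insert_iff, Set.mem_image, Finset.mem_coe, not_or,
    not_exists, not_and] at hσ
  obtain ⟨hσs, hσF⟩ := hσ
  rcases le_or_gt σ 0 with h0 | h0
  · exact Eventually.of_forall fun p => iff_of_false (fun h => h0.not_gt h.2.1)
      (fun h => h0.not_gt h.2.1)
  have hlt : ∀ {Y : Type} [TopologicalSpace Y] {f : Y → ℝ} {a : Y}, Continuous f → σ ≠ f a →
      ∀ᶠ b in 𝓝 a, (σ < f b ↔ σ < f a) := by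
    intro Y _ f a hf hne
    rcases hne.lt_or_gt with h | h
    · filter_upwards [(hf.tendsto a).eventually_const_lt h] with b hb
      exact iff_of_true hb h
    · filter_upwards [(hf.tendsto a).eventually_lt_const h] with b hb
      exact iff_of_false hb.not_gt h.not_gt
  have hFev : ∀ᶠ y in 𝓝 x, ∀ v ∈ F, (σ < y.1 v ↔ σ < x.1 v) :=
    (Finset.eventually_all F).mpr fun v hv =>
      hlt (continuous_coord v) fun h => hσF v hv h.symm
  have hx : ∀ᶠ y in 𝓝 x, ∀ v, (σ < y.1 v ↔ σ < x.1 v) := by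
    filter_upwards [hFev, eventually_coord_lt x hF1 h0] with y h1 h2 v
    by_cases hv : v ∈ F
    · exact h1 v hv
    · have hxv : x.1 v = 0 := not_not.mp fun h => hv ((hF v).mpr h)
      exact iff_of_false (h2 v hv).not_gt (by rw [hxv]; exact h0.not_gt)
  have hs : ∀ᶠ t : unitInterval in 𝓝 s, (σ < (t : ℝ) ↔ σ < (s : ℝ)) :=
    hlt continuous_subtype_val hσs
  rw [nhds_prod_eq]
  filter_upwards [hs.prod_mk hx] with p hp
  have hlev : outerLevel L p.2.1 σ = outerLevel L x.1 σ := by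
    ext v
    simp only [outerLevel, Set.mem_ofPred_eq, hp.2 v]
  simp only [transferLevels, Set.mem_ofPred_eq, hlev, hp.1, hp.2 u]

lemma continuous_push :
    Continuous fun p : unitInterval × X.space => push L c p.1 p.2.1 := by
  refine continuous_pi fun w => ?_
  have hx : Continuous fun p : unitInterval × X.space => p.2.1 w :=
    (continuous_coord w).comp continuous_snd
  by_cases hw : ({w} : Finset V) ∈ L.faces
  · simp only [push, if_pos hw]
    refine hx.add (continuous_iff_continuousAt.mpr fun p => ?_)
    exact tendsto_tsum_of_le_coord (continuous_snd.tendsto p)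
      (f := fun q u => transfer L c q.2.1 q.1 u w)
      (g := fun y u => transfer L c y.1 p.1 u w)
      (fun q u => transfer_nonneg _ _ _ _) (fun q u => transfer_le q.2 _ _ _)
      (fun u => transfer_nonneg _ _ _ _) (fun u => transfer_le _ _ _ _)
      (fun u => (continuous_transfer u w).tendsto p)
  · simp only [push, if_neg hw]
    exact (hx.sub (continuous_subtype_val.comp continuous_fst)).max continuous_const

lemma push_nonneg (x : X.space) (s : ℝ) (w : V) : 0 ≤ push L c s x.1 w := by
  unfold push
  split_ifs
  · exact add_nonneg (x.2.1 w) (tsum_nonneg fun u => transfer_nonneg _ _ _ _)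
  · exact le_max_right _ _

lemma transfer_eq_zero_of_mem {u : V} (hu : ({u} : Finset V) ∈ L.faces) (x : V → ℝ) (s : ℝ)
    (w : V) : transfer L c x s u w = 0 := by
  have : transferLevels L c x s u w = ∅ := by
    ext σ
    simp [transferLevels, hu]
  rw [transfer, this, measureReal_empty]

lemma push_zero (x : X.space) : push L c 0 x.1 = x.1 := by
  ext w
  unfold push
  split_ifs
  · have : ∀ u, transfer L c x.1 0 u w = 0 := fun u => by
      have h : transferLevels L c x.1 0 u w = ∅ :=
        Set.eq_empty_of_forall_notMem fun σ h => lt_asymm h.2.1 h.2.2.2.1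
      rw [transfer, h, measureReal_empty]
    simp [this]
  · rw [sub_zero, max_eq_left (x.2.1 w)]

/-- Points supported on vertices of `L` do not move. -/
lemma push_eq_self (x : X.space) {s : ℝ} (hs : 0 ≤ s)
    (hx : ∀ u, x.1 u ≠ 0 → ({u} : Finset V) ∈ L.faces) : push L c s x.1 = x.1 := by
  ext w
  unfold push
  split_ifs with hw
  · have : ∀ u, transfer L c x.1 s u w = 0 := fun u => by
      by_cases hu : x.1 u = 0
      · exact transfer_eq_zero_of_coord x hu s w
      · exact transfer_eq_zero_of_mem (hx u hu) _ _ _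
    simp [this]
  · have h0 : x.1 w = 0 := not_not.mp fun h => hw (hx w h)
    rw [h0, max_eq_right (by linarith)]

/-- A vertex of `L` in the support of a pushed weighting was either there before,
or it was chosen at some level. -/
lemma of_push_ne_zero {x : V → ℝ} {s : ℝ} {w : V} (hw : ({w} : Finset V) ∈ L.faces)
    (h : push L c s x w ≠ 0) :
    x w ≠ 0 ∨ ∃ u σ, σ ∈ transferLevels L c x s u w := by
  by_contra! hcon
  apply h
  have : ∀ u, transfer L c x s u w = 0 := fun u => by
    rw [transfer, Set.eq_empty_of_forall_notMem (hcon.2 u), measureReal_empty]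
  simp [push, hw, this, hcon.1]

lemma sum_transfer (x : X.space) {s : ℝ} (hs : 0 ≤ s) {u : V} (hu : ({u} : Finset V) ∉ L.faces)
    (E : Finset V) (hE : ∀ σ, 0 < σ → σ < x.1 u → c (outerLevel L x.1 σ) ∈ E) :
    ∑ w ∈ E, transfer L c x.1 s u w = min (x.1 u) s := by
  have hU : ⋃ w ∈ E, transferLevels L c x.1 s u w = Set.Ioo 0 (min (x.1 u) s) := by
    ext σ
    simp only [Set.mem_iUnion, exists_prop]
    constructor
    · rintro ⟨w, -, h⟩
      exact transferLevels_subset _ _ _ _ h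
    · rintro ⟨h0, h1⟩
      rw [lt_min_iff] at h1
      exact ⟨_, hE σ h0 h1.1, hu, h0, h1.1, h1.2, rfl⟩
  unfold transfer
  rw [← measureReal_biUnion_finset ?_ (fun w _ => measurableSet_transferLevels x s u w)
    (fun w _ => volume_transferLevels_ne_top _ _ _ _), hU, Real.volume_real_Ioo_of_le (le_min (x.2.1 u) hs), sub_zero]
  intro w _ w' _ hne
  exact Set.disjoint_left.mpr fun σ h h' => hne (h.2.2.2.2.symm.trans h'.2.2.2.2)

/-- Pushing preserves the total mass, provided all chosen targets are vertices of `L`. -/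
lemma exists_sum_push_eq_one (x : X.space) {s : ℝ} (hs : 0 ≤ s)
    (hc : ∀ σ, 0 < σ → (outerLevel L x.1 σ).Nonempty →
      ({c (outerLevel L x.1 σ)} : Finset V) ∈ L.faces) :
    ∃ E : Finset V, (∀ w, push L c s x.1 w ≠ 0 → w ∈ E) ∧ ∑ w ∈ E, push L c s x.1 w = 1 := by
  classical
  obtain ⟨F, -, hF, hF1⟩ := exists_support_mem_faces x
  have hF0 : ∀ u ∉ F, x.1 u = 0 := fun u hu => not_not.mp fun h => hu ((hF u).mpr h)
  let E : Finset V := F ∪ F.powerset.image fun T : Finset V => c (T : Set V)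
  have hcE : ∀ σ, 0 < σ → c (outerLevel L x.1 σ) ∈ E := by
    intro σ h0
    have hT : outerLevel L x.1 σ =
        ((F.filter fun v => v ∈ outerLevel L x.1 σ : Finset V) : Set V) := by
      ext v
      simp only [Finset.coe_filter, Set.mem_ofPred_eq]
      exact ⟨fun h => ⟨(hF v).mpr (h0.trans h.2).ne', h⟩, fun h => h.2⟩
    rw [hT]
    exact Finset.mem_union_right _ (Finset.mem_image.mpr ⟨_, by simp, rfl⟩)
  refine ⟨E, fun w hw => ?_, ?_⟩
  · by_cases hwL : ({w} : Finset V) ∈ L.faces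
    · rcases of_push_ne_zero hwL hw with h | ⟨u, σ, h⟩
      · exact Finset.mem_union_left _ ((hF w).mpr h)
      · exact h.2.2.2.2 ▸ hcE σ h.2.1
    · refine Finset.mem_union_left _ ((hF w).mpr fun h => hw ?_)
      rw [push, if_neg hwL, h, max_eq_right (by linarith)]
  · have hts : ∀ w, ∑' u, transfer L c x.1 s u w = ∑ u ∈ F, transfer L c x.1 s u w := fun w =>
      tsum_eq_sum fun u hu => transfer_eq_zero_of_coord x (hF0 u hu) s w
    have hFE : F ⊆ E := Finset.subset_union_left
    have hin : ∀ u ∈ F, ∑ w ∈ E with ({w} : Finset V) ∈ L.faces, transfer L c x.1 s u w =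
        if ({u} : Finset V) ∈ L.faces then 0 else min (x.1 u) s := by
      intro u _
      split_ifs with hu
      · exact Finset.sum_eq_zero fun w _ => transfer_eq_zero_of_mem hu _ _ _
      · refine sum_transfer x hs hu _ fun σ h0 h1 => ?_
        exact Finset.mem_filter.mpr ⟨hcE σ h0, hc σ h0 ⟨u, hu, h1⟩⟩
    have hmax : ∀ w, max (x.1 w - s) 0 = x.1 w - min (x.1 w) s := fun w => by
      rcases le_total (x.1 w) s with h | h
      · rw [min_eq_left h, max_eq_right (by linarith), sub_self]
      · rw [min_eq_right h, max_eq_left (by linarith)]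
    unfold push
    rw [Finset.sum_ite, Finset.sum_add_distrib]
    simp only [hts, hmax]
    rw [Finset.sum_comm, Finset.sum_congr rfl hin, Finset.sum_ite, Finset.sum_const_zero, zero_add,
      Finset.sum_sub_distrib]
    have hmin : ∑ w ∈ E with ({w} : Finset V) ∉ L.faces, min (x.1 w) s =
        ∑ w ∈ F with ({w} : Finset V) ∉ L.faces, min (x.1 w) s := by
      symm
      refine Finset.sum_subset (Finset.filter_subset_filter _ hFE) fun w hwE hwF => ?_
      have : w ∉ F := fun h => hwF (Finset.mem_filter.mpr ⟨h, (Finset.mem_filter.mp hwE).2⟩)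
      rw [hF0 w this, min_eq_left hs]
    have hx : ∑ w ∈ E with ({w} : Finset V) ∈ L.faces, x.1 w +
        ∑ w ∈ E with ({w} : Finset V) ∉ L.faces, x.1 w = 1 := by
      rw [Finset.sum_filter_add_sum_filter_not]
      exact (Finset.sum_subset hFE fun w _ hw => hF0 w hw).symm.trans hF1
    rw [hmin]
    linarith

end Push

section StarUnion

variable {V : Type}

lemma vertex_of_mem {K : AbsSC V} {s : Finset V} (hs : s ∈ K.faces) {v : V} (hv : v ∈ s) :
    ({v} : Finset V) ∈ K.faces :=
  K.down_closed _ hs _ (by simpa using hv) (by simp)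

variable [DecidableEq V] {K L X : AbsSC V}

lemma edge_of_mem {K : AbsSC V} {s : Finset V} (hs : s ∈ K.faces) {v w : V} (hv : v ∈ s)
    (hw : w ∈ s) : ({v, w} : Finset V) ∈ K.faces :=
  K.down_closed _ hs _ (by simp [Finset.insert_subset_iff, hv, hw]) (by simp)

lemma IsCliqueCx.mem_of_edges (hK : IsCliqueCx K) {s : Finset V} (hs : s ≠ ∅)
    (h : ∀ v ∈ s, ∀ w ∈ s, ({v, w} : Finset V) ∈ K.faces) : s ∈ K.faces :=
  hK s hs (fun v hv => by simpa using h v hv v hv) fun v hv w hw _ => h v hv w hw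

/-- Two vertices of `L` lying in a common star outside `L` span an edge of `L`. -/
def StarEdges (K L : AbsSC V) : Prop :=
  ∀ v w : V, ({v} : Finset V) ∈ L.faces → ({w} : Finset V) ∈ L.faces →
    (∃ σ, σ ∈ (K.star v).faces ∧ σ ∈ (K.star w).faces ∧ σ ∉ L.faces) →
    ({v, w} : Finset V) ∈ L.faces

/-- The vertices of `L` adjacent in `K` to all vertices of `β`. -/
def commonNbrs (K L : AbsSC V) (β : Set V) : Set V :=
  {v | ({v} : Finset V) ∈ L.faces ∧ ∀ u ∈ β, ({u, v} : Finset V) ∈ K.faces}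

lemma commonNbrs_antitone : Antitone (commonNbrs K L) :=
  fun _ _ h _ hv => ⟨hv.1, fun u hu => hv.2 u (h hu)⟩

lemma StarEdges.edge_mem (h : StarEdges K L) {β : Set V} {u v w : V} (hu : u ∈ β)
    (huL : ({u} : Finset V) ∉ L.faces) (hv : v ∈ commonNbrs K L β) (hw : w ∈ commonNbrs K L β) :
    ({v, w} : Finset V) ∈ L.faces :=
  h v w hv.1 hw.1 ⟨{u}, ⟨by simp, hv.2 u hu⟩, ⟨by simp, hw.2 u hu⟩, huL⟩

lemma StarEdges.isFull (h : StarEdges K L) (hL : IsCliqueCx L) : IsFull L K := by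
  intro σ hσ hv
  refine hL σ (fun h => K.not_empty_mem (h ▸ hσ)) hv fun v hvσ w hwσ _ => ?_
  by_contra hvw
  have hK := edge_of_mem hσ hvσ hwσ
  refine hvw (h v w (hv v hvσ) (hv w hwσ) ⟨{v, w}, ⟨by simp, ?_⟩, ⟨by simp, ?_⟩, hvw⟩)
  · rwa [Finset.union_eq_left.mpr (by simp)]
  · rwa [Finset.union_eq_left.mpr (by simp)]

/-- The faces of `X` are those of `L` and of the stars in `K` of the vertices in `S`. -/
def IsStarUnion (K L X : AbsSC V) (S : Set V) : Prop :=
  ∀ σ, σ ∈ X.faces ↔ σ ∈ L.faces ∨ ∃ v ∈ S, σ ∈ (K.star v).faces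

variable {S : Set V} {c : Set V → V}

lemma exists_center (hX : IsStarUnion K L X S) (hS : ∀ v ∈ S, ({v} : Finset V) ∈ L.faces)
    (x : X.space) {u : V} (hu : x.1 u ≠ 0) (huL : ({u} : Finset V) ∉ L.faces) :
    ∃ F ∈ K.faces, (∀ w, x.1 w ≠ 0 → w ∈ F) ∧ ∃ v ∈ F, v ∈ S ∧ ({v} : Finset V) ∈ L.faces := by
  obtain ⟨F, hFX, hF, -⟩ := exists_support_mem_faces x
  rcases (hX F).mp hFX with h | ⟨v, hv, h⟩
  · exact absurd (vertex_of_mem h ((hF u).mpr hu)) huL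
  · exact ⟨F ∪ {v}, h.2, fun w hw => Finset.mem_union_left _ ((hF w).mpr hw), v, by simp, hv,
      hS v hv⟩

lemma commonNbrs_outerLevel_nonempty (hX : IsStarUnion K L X S)
    (hS : ∀ v ∈ S, ({v} : Finset V) ∈ L.faces) (x : X.space) {σ : ℝ} (hσ : 0 ≤ σ)
    (h : (outerLevel L x.1 σ).Nonempty) : (commonNbrs K L (outerLevel L x.1 σ)).Nonempty := by
  obtain ⟨u, hu⟩ := h
  obtain ⟨F, hFK, hF, v, hvF, -, hvL⟩ := exists_center hX hS x (hσ.trans_lt hu.2).ne' hu.1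
  exact ⟨v, hvL, fun t ht => edge_of_mem hFK (hF t (hσ.trans_lt ht.2).ne') hvF⟩

lemma push_mem_space (hK : IsCliqueCx K) (hL : IsCliqueCx L) (hsub : IsSubcomplex L K)
    (hE : StarEdges K L) (hX : IsStarUnion K L X S) (hS : ∀ v ∈ S, ({v} : Finset V) ∈ L.faces)
    (hc : ∀ β, (commonNbrs K L β).Nonempty → c β ∈ commonNbrs K L β)
    (Y : AbsSC V) (hLY : L.faces ⊆ Y.faces) (x : X.space) {s : ℝ} (hs : 0 ≤ s)
    (hXY : X.faces ⊆ Y.faces ∨ s = 1) :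
    (∀ v, 0 ≤ push L c s x.1 v) ∧ ∃ T ∈ Y.faces, (∀ v, push L c s x.1 v ≠ 0 → v ∈ T) ∧
      ∑ v ∈ T, push L c s x.1 v = 1 := by
  have hcx : ∀ σ, 0 ≤ σ → (outerLevel L x.1 σ).Nonempty →
      c (outerLevel L x.1 σ) ∈ commonNbrs K L (outerLevel L x.1 σ) := fun σ h0 h =>
    hc _ (commonNbrs_outerLevel_nonempty hX hS x h0 h)
  obtain ⟨E, hsupp, hsum⟩ := exists_sum_push_eq_one (c := c) x hs
    fun σ h0 h => (hcx σ h0.le h).1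
  refine mem_space_of_support (push_nonneg x s) E hsupp hsum fun T hT hmem => ?_
  by_cases hout : ∃ u, x.1 u ≠ 0 ∧ ({u} : Finset V) ∉ L.faces
  swap
  · push Not at hout
    rw [push_eq_self x hs hout] at hmem
    obtain ⟨F, hFX, hF, -⟩ := exists_support_mem_faces x
    have hTF : T = F := by
      ext v
      rw [hmem, hF]
    have hFL : F ∈ L.faces := by
      rcases (hX F).mp hFX with h | ⟨v, -, h⟩
      · exact h
      · refine hE.isFull hL F (K.down_closed _ h.2 _ Finset.subset_union_left h.1) fun v hv => ?_
        exact hout v ((hF v).mp hv)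
    exact hLY (hTF ▸ hFL)
  obtain ⟨u₀, hu₀, hu₀L⟩ := hout
  obtain ⟨F, hFK, hF, v₀, hv₀F, hv₀S, hv₀L⟩ := exists_center hX hS x hu₀ hu₀L
  have hne0 : (outerLevel L x.1 0).Nonempty := ⟨u₀, hu₀L, lt_of_le_of_ne (x.2.1 u₀) hu₀.symm⟩
  -- Each vertex of `L` involved is a common neighbour of some outer level not above `s`.
  have hinF : ∀ w ∈ F, ({w} : Finset V) ∈ L.faces →
      w ∈ commonNbrs K L (outerLevel L x.1 0) := fun w hw hwL =>
    ⟨hwL, fun t ht => edge_of_mem hFK (hF t ht.2.ne') hw⟩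
  have hinner : ∀ w ∈ insert v₀ T, ({w} : Finset V) ∈ L.faces → ∃ σ, 0 ≤ σ ∧ σ ≤ s ∧
      (outerLevel L x.1 σ).Nonempty ∧ w ∈ commonNbrs K L (outerLevel L x.1 σ) := by
    intro w hw hwL
    rcases Finset.mem_insert.mp hw with rfl | hw
    · exact ⟨0, le_rfl, hs, hne0, hinF _ hv₀F hwL⟩
    rcases of_push_ne_zero hwL ((hmem w).mp hw) with h | ⟨u, σ, h⟩
    · exact ⟨0, le_rfl, hs, hne0, hinF _ (hF w h) hwL⟩
    · have hne : (outerLevel L x.1 σ).Nonempty := ⟨u, h.1, h.2.2.1⟩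
      exact ⟨σ, h.2.1.le, h.2.2.2.1.le, hne, h.2.2.2.2 ▸ hcx σ h.2.1.le hne⟩
  have houter : ∀ w ∈ insert v₀ T, ({w} : Finset V) ∉ L.faces → s < x.1 w := by
    intro w hw hwL
    rcases Finset.mem_insert.mp hw with rfl | hw
    · exact absurd hv₀L hwL
    have h := (hmem w).mp hw
    rw [push, if_neg hwL] at h
    by_contra hcon
    exact h (max_eq_right (by linarith))
  have hLL : ∀ v ∈ insert v₀ T, ∀ w ∈ insert v₀ T, ({v} : Finset V) ∈ L.faces →
      ({w} : Finset V) ∈ L.faces → ({v, w} : Finset V) ∈ L.faces := by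
    intro v hv w hw hvL hwL
    obtain ⟨σ, -, -, ⟨u, hu⟩, hvσ⟩ := hinner v hv hvL
    obtain ⟨τ, -, -, ⟨t, ht⟩, hwτ⟩ := hinner w hw hwL
    rcases le_total σ τ with h | h
    · exact hE.edge_mem ht ht.1 (commonNbrs_antitone (outerLevel_antitone x.1 h) hvσ) hwτ
    · exact hE.edge_mem hu hu.1 hvσ (commonNbrs_antitone (outerLevel_antitone x.1 h) hwτ)
  have hOL : ∀ v ∈ insert v₀ T, ∀ w ∈ insert v₀ T, ({v} : Finset V) ∉ L.faces →
      ({w} : Finset V) ∈ L.faces → ({v, w} : Finset V) ∈ K.faces := by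
    intro v hv w hw hvL hwL
    obtain ⟨σ, -, hσs, -, hwσ⟩ := hinner w hw hwL
    exact hwσ.2 v ⟨hvL, hσs.trans_lt (houter v hv hvL)⟩
  by_cases hTL : ∀ v ∈ T, ({v} : Finset V) ∈ L.faces
  · exact hLY (hL.mem_of_edges hT fun v hv w hw => hLL v (Finset.mem_insert_of_mem hv) w
      (Finset.mem_insert_of_mem hw) (hTL v hv) (hTL w hw))
  push Not at hTL
  obtain ⟨u, huT, huL⟩ := hTL
  rcases hXY with hXY | rfl
  swap
  · exact absurd (houter u (Finset.mem_insert_of_mem huT) huL) (space_le_one x u).not_gt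
  refine hXY ((hX T).mpr (Or.inr ⟨v₀, hv₀S, hT, ?_⟩))
  rw [Finset.union_comm, ← Finset.insert_eq]
  refine hK.mem_of_edges (Finset.insert_ne_empty _ _) fun v hv w hw => ?_
  by_cases hvL : ({v} : Finset V) ∈ L.faces <;> by_cases hwL : ({w} : Finset V) ∈ L.faces
  · exact hsub (hLL v hv w hw hvL hwL)
  · rw [Finset.pair_comm]
    exact hOL w hw v hv hwL hvL
  · exact hOL v hv w hw hvL hwL
  · exact edge_of_mem hFK (hF v (hs.trans_lt (houter v hv hvL)).ne')
      (hF w (hs.trans_lt (houter w hw hwL)).ne')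

/-- Adjoining to `L` the stars of any set of its vertices does not change the homotopy type. -/
theorem hEquiv_of_isStarUnion (hK : IsCliqueCx K) (hL : IsCliqueCx L) (hsub : IsSubcomplex L K)
    (hE : StarEdges K L) (hX : IsStarUnion K L X S)
    (hS : ∀ v ∈ S, ({v} : Finset V) ∈ L.faces) : HEquiv X L := by
  classical
  rcases isEmpty_or_nonempty V with hV | hV
  · have hempty : ∀ Y : AbsSC V, IsEmpty Y.space := fun Y => ⟨fun y => by
      obtain ⟨-, s, hs, -⟩ := y.2
      exact Y.not_empty_mem (Finset.eq_empty_of_isEmpty s ▸ hs)⟩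
    have := hempty X
    have := hempty L
    exact ⟨(Homeomorph.empty : X.space ≃ₜ L.space).toHomotopyEquiv⟩
  have hLX : L.faces ⊆ X.faces := fun σ h => (hX σ).mpr (Or.inl h)
  set c : Set V → V := fun β => Classical.epsilon fun v => v ∈ commonNbrs K L β
  have hc : ∀ β, (commonNbrs K L β).Nonempty → c β ∈ commonNbrs K L β :=
    fun β h => Classical.epsilon_spec h
  have hcont := continuous_push (X := X) (L := L) (c := c)
  let r : C(X.space, L.space) :=
    { toFun := fun x => ⟨push L c 1 x.1, push_mem_space hK hL hsub hE hX hS hc L subset_rfl x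
        zero_le_one (Or.inr rfl)⟩
      continuous_toFun := Continuous.subtype_mk
        (hcont.comp (Continuous.prodMk_right (1 : unitInterval))) _ }
  let H : C(unitInterval × X.space, X.space) :=
    { toFun := fun p => ⟨push L c p.1 p.2.1, push_mem_space hK hL hsub hE hX hS hc X hLX p.2
        p.1.2.1 (Or.inl subset_rfl)⟩
      continuous_toFun := Continuous.subtype_mk hcont _ }
  have hri : r.comp (incl hLX) = ContinuousMap.id _ := by
    ext y
    refine Subtype.ext (push_eq_self (X := L) y zero_le_one fun u hu => ?_)
    obtain ⟨s, hs, hsupp, -⟩ := y.2.2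
    exact vertex_of_mem hs (hsupp u hu)
  have hir : ContinuousMap.Homotopic ((incl hLX).comp r) (ContinuousMap.id _) :=
    ContinuousMap.Homotopic.symm ⟨{
      toContinuousMap := H
      map_zero_left := fun x => Subtype.ext (push_zero x)
      map_one_left := fun x => rfl }⟩
  exact ⟨{ toFun := r
           invFun := incl hLX
           left_inv := hir
           right_inv := hri ▸ ContinuousMap.Homotopic.refl _ }⟩

end StarUnion

end AbsSC

/-- Let `K` be a clique complex and `L` a clique subcomplex such that the
edge `{v,w}` is in `L` for every pair of vertices `v, w` of `L` with
`(st_K(v) ∩ st_K(w)) \ L ≠ ∅`. Then (i) `L` is a full subcomplex of `K`; (ii) for any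
vertices `v_1, …, v_ℓ` of `L`, the complex `L ∪ st_K(v_1) ∪ ⋯ ∪ st_K(v_ℓ)` is homotopy
equivalent to `L`; in particular `SC_K(L) ≃ L`. -/
theorem stmt2 {V : Type} [DecidableEq V] (K L : AbsSC V)
    (hKcl : AbsSC.IsCliqueCx K) (hLcl : AbsSC.IsCliqueCx L)
    (hsub : AbsSC.IsSubcomplex L K)
    (hcond : ∀ v w : V, ({v} : Finset V) ∈ L.faces → ({w} : Finset V) ∈ L.faces →
      (∃ σ, σ ∈ (K.star v).faces ∧ σ ∈ (K.star w).faces ∧ σ ∉ L.faces) →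
      ({v, w} : Finset V) ∈ L.faces) :
    AbsSC.IsFull L K ∧
    (∀ (ℓ : ℕ) (v : Fin ℓ → V), (∀ j, ({v j} : Finset V) ∈ L.faces) →
      AbsSC.HEquiv (L.union (AbsSC.iUnionC fun j => K.star (v j))) L) ∧
    AbsSC.HEquiv (K.starCluster L) L := by
  have hE : AbsSC.StarEdges K L := hcond
  refine ⟨hE.isFull hLcl, fun ℓ v hv => ?_, ?_⟩
  · refine AbsSC.hEquiv_of_isStarUnion (S := Set.range v) hKcl hLcl hsub hE (fun σ => ?_) ?_
    · simp [AbsSC.union, AbsSC.iUnionC]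
    · rintro _ ⟨j, rfl⟩
      exact hv j
  · refine AbsSC.hEquiv_of_isStarUnion (S := L.vertices) hKcl hLcl hsub hE (fun σ => ?_)
      fun v hv => hv
    constructor
    · rintro ⟨hne, v, hv, hσ⟩
      exact Or.inr ⟨v, hv, hne, hσ⟩
    · rintro (h | ⟨v, hv, hne, hσ⟩)
      · have hne : σ ≠ ∅ := fun h0 => L.not_empty_mem (h0 ▸ h)
        obtain ⟨v, hv⟩ := Finset.nonempty_iff_ne_empty.mpr hne
        refine ⟨hne, v, AbsSC.vertex_of_mem h hv, ?_⟩
        rw [Finset.union_eq_left.mpr (by simpa using hv)]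
        exact hsub h
      · exact ⟨hne, v, hv, hσ⟩
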